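/- Let n ≥ k ≥ 1 and let 𝓕 ⊆ 2^[n] be an s-extremal set system all of whose members have cardinality k or k−1 (i.e. 𝓕 ⊆ C([n],k) ∪ C([n],k−1)). Then the VC-dimension of 𝓕 is at most 1. -/

import Mathlib

open Finset

/-- The family of subsets of `[n]` (identified with `Fin n`) shattered by the
set system `F ⊆ 2^[n]`. -/
def Sh (n : ℕ) (F : Finset (Finset (Fin n))) : Finset (Finset (Fin n)) :=
  Finset.univ.filter (fun S => ∀ H ∈ S.powerset, ∃ A ∈ F, A ∩ S = H)

/-- A set system is shattering-extremal (s-extremal) if it shatters exactly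
`|F|` sets. -/
def SExtremal (n : ℕ) (F : Finset (Finset (Fin n))) : Prop :=
  (Sh n F).card = F.card

/-- The inclusion graph of a set system: vertices are the members of `F`,
two sets adjacent iff their symmetric difference is a single element. -/
def inclGraph (n : ℕ) (F : Finset (Finset (Fin n))) : SimpleGraph {A // A ∈ F} where
  Adj A B := (symmDiff A.1 B.1).card = 1
  symm := by constructor; intro A B h; rwa [symmDiff_comm]
  loopless := by constructor; intro A h; simp [symmDiff_self] at h

namespace Finset

variable {α : Type*} [DecidableEq α] {𝒜 : Finset (Finset α)} {s : Finset α} {a : α}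

lemma notMem_of_shatters_filter_mem (h : Shatters {t ∈ 𝒜 | a ∈ t} s) : a ∉ s := fun ha ↦ by
  obtain ⟨t, ht, hst⟩ := h (empty_subset s)
  exact notMem_empty a (hst ▸ mem_inter.2 ⟨ha, (mem_filter.1 ht).2⟩)

lemma notMem_of_shatters_filter_notMem (h : Shatters {t ∈ 𝒜 | a ∉ t} s) : a ∉ s := fun ha ↦ by
  obtain ⟨t, ht, hst⟩ := h Subset.rfl
  exact (mem_filter.1 ht).2 (inter_eq_left.1 hst ha)

lemma Shatters.insert_of_filter (h₁ : Shatters {t ∈ 𝒜 | a ∈ t} s)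
    (h₀ : Shatters {t ∈ 𝒜 | a ∉ t} s) : 𝒜.Shatters (insert a s) := by
  intro u hu
  by_cases ha : a ∈ u
  · obtain ⟨t, ht, hst⟩ := h₁ (subset_insert_iff.1 hu)
    rw [mem_filter] at ht
    exact ⟨t, ht.1, by rw [insert_inter_of_mem ht.2, hst, insert_erase ha]⟩
  · obtain ⟨t, ht, hst⟩ := h₀ ((subset_insert_iff_of_notMem ha).1 hu)
    rw [mem_filter] at ht
    exact ⟨t, ht.1, by rw [insert_inter_of_notMem ht.2, hst]⟩

/-- Splitting a set family along `a` splits at most its share of the shattered sets. -/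
lemma card_shatterer_filter_add_le (𝒜 : Finset (Finset α)) (a : α) :
    #(shatterer {t ∈ 𝒜 | a ∈ t}) + #(shatterer {t ∈ 𝒜 | a ∉ t}) ≤
      #(shatterer {t ∈ 𝒜 | a ∈ t} ∪ shatterer {t ∈ 𝒜 | a ∉ t}) + #{s ∈ 𝒜.shatterer | a ∈ s} := by
  rw [← card_union_add_card_inter]
  refine Nat.add_le_add_left ?_ _
  refine card_le_card_of_injOn (insert a) (fun s hs ↦ ?_) (fun s hs t ht hst ↦ ?_)
  · simp only [mem_coe, mem_inter, mem_shatterer] at hs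
    simpa using hs.1.insert_of_filter hs.2
  · simp only [mem_coe, mem_inter, mem_shatterer] at hs ht
    rw [← erase_insert (notMem_of_shatters_filter_mem hs.1), hst,
      erase_insert (notMem_of_shatters_filter_mem ht.1)]

lemma shatterer_filter_union_subset (𝒜 : Finset (Finset α)) (a : α) :
    shatterer {t ∈ 𝒜 | a ∈ t} ∪ shatterer {t ∈ 𝒜 | a ∉ t} ⊆ {s ∈ 𝒜.shatterer | a ∉ s} := by
  refine union_subset (fun s hs ↦ ?_) (fun s hs ↦ ?_) <;> rw [mem_shatterer] at hs
  · simpa using ⟨hs.mono_left (filter_subset _ _), notMem_of_shatters_filter_mem hs⟩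
  · simpa using ⟨hs.mono_left (filter_subset _ _), notMem_of_shatters_filter_notMem hs⟩

/-- In a shattering-extremal family, a shattered set avoiding `a` is shattered by one of the two
halves of the family along `a`, which are themselves extremal. -/
lemma Shatters.filter_of_card_shatterer_le (hext : #𝒜.shatterer ≤ #𝒜) (hs : 𝒜.Shatters s)
    (ha : a ∉ s) :
    (#(shatterer {t ∈ 𝒜 | a ∈ t}) ≤ #{t ∈ 𝒜 | a ∈ t} ∧ Shatters {t ∈ 𝒜 | a ∈ t} s) ∨
      (#(shatterer {t ∈ 𝒜 | a ∉ t}) ≤ #{t ∈ 𝒜 | a ∉ t} ∧ Shatters {t ∈ 𝒜 | a ∉ t} s) := by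
  have hadd := card_shatterer_filter_add_le 𝒜 a
  have hsub := shatterer_filter_union_subset 𝒜 a
  have hle := card_le_card hsub
  have h₁ := card_le_card_shatterer {t ∈ 𝒜 | a ∈ t}
  have h₀ := card_le_card_shatterer {t ∈ 𝒜 | a ∉ t}
  have h𝒜 := card_filter_add_card_filter_not (s := 𝒜) (fun t ↦ a ∈ t)
  have hsh := card_filter_add_card_filter_not (s := 𝒜.shatterer) (fun t ↦ a ∈ t)
  have heq := eq_of_subset_of_card_le hsub (by omega)
  have hmem : s ∈ shatterer {t ∈ 𝒜 | a ∈ t} ∪ shatterer {t ∈ 𝒜 | a ∉ t} := by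
    simpa [heq] using ⟨hs, ha⟩
  rw [mem_union, mem_shatterer, mem_shatterer] at hmem
  exact hmem.imp (⟨by omega, ·⟩) (⟨by omega, ·⟩)

/-- A set shattered by a shattering-extremal family remains shattered by a subfamily whose members
all agree on a prescribed set disjoint from it. -/
lemma Shatters.exists_subfamily_inter_eq (hext : #𝒜.shatterer ≤ #𝒜) (hs : 𝒜.Shatters s)
    {u : Finset α} (hu : Disjoint u s) :
    ∃ ℬ ⊆ 𝒜, ℬ.Shatters s ∧ ∃ v, ∀ t ∈ ℬ, t ∩ u = v := by
  induction u using Finset.induction_on generalizing 𝒜 with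
  | empty => exact ⟨𝒜, Subset.rfl, hs, ∅, by simp⟩
  | insert a u _ ih =>
    rw [disjoint_insert_left] at hu
    obtain ⟨hext', hs'⟩ | ⟨hext', hs'⟩ := hs.filter_of_card_shatterer_le hext hu.1
    · obtain ⟨ℬ, hℬ, hsℬ, v, hv⟩ := ih hext' hs' hu.2
      refine ⟨ℬ, hℬ.trans (filter_subset _ _), hsℬ, insert a v, fun t ht ↦ ?_⟩
      rw [inter_insert_of_mem (mem_filter.1 (hℬ ht)).2, hv t ht]
    · obtain ⟨ℬ, hℬ, hsℬ, v, hv⟩ := ih hext' hs' hu.2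
      refine ⟨ℬ, hℬ.trans (filter_subset _ _), hsℬ, v, fun t ht ↦ ?_⟩
      rw [inter_insert_of_notMem (mem_filter.1 (hℬ ht)).2, hv t ht]

/-- A shattering-extremal family has members whose sizes differ by the size of any shattered set. -/
lemma Shatters.exists_card_eq_add_card [Fintype α] (hext : #𝒜.shatterer ≤ #𝒜)
    (hs : 𝒜.Shatters s) : ∃ t₀ ∈ 𝒜, ∃ t₁ ∈ 𝒜, #t₁ = #t₀ + #s := by
  obtain ⟨ℬ, hℬ, hsℬ, v, hv⟩ := hs.exists_subfamily_inter_eq hext disjoint_compl_left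
  obtain ⟨t₀, ht₀, h₀⟩ := hsℬ (empty_subset s)
  obtain ⟨t₁, ht₁, h₁⟩ := hsℬ Subset.rfl
  refine ⟨t₀, hℬ ht₀, t₁, hℬ ht₁, ?_⟩
  have hsplit (t : Finset α) : #(s ∩ t) + #(t ∩ sᶜ) = #t := by
    rw [inter_comm, ← sdiff_eq_inter_compl, card_inter_add_card_sdiff]
  rw [← hsplit t₀, ← hsplit t₁, hv t₀ ht₀, hv t₁ ht₁, h₀, h₁, card_empty]
  omega

end Finset

lemma Sh_eq_shatterer (n : ℕ) (F : Finset (Finset (Fin n))) : Sh n F = F.shatterer := by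
  ext S
  simp [Sh, Shatters, inter_comm]

/-- An s-extremal set system contained in two consecutive layers
`C([n],k) ∪ C([n],k-1)` has VC-dimension at most 1. -/
theorem stmt4 (n k : ℕ) (hk : 1 ≤ k) (hkn : k ≤ n) (F : Finset (Finset (Fin n)))
    (hlayers : ∀ A ∈ F, A.card = k ∨ A.card = k - 1)
    (hext : SExtremal n F) :
    ∀ S ∈ Sh n F, S.card ≤ 1 := by
  intro S hS
  rw [SExtremal, Sh_eq_shatterer] at hext
  rw [Sh_eq_shatterer, mem_shatterer] at hS
  obtain ⟨A, hA, B, hB, hAB⟩ := hS.exists_card_eq_add_card hext.le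
  have hA' := hlayers A hA
  have hB' := hlayers B hB
  omega
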